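/- Let G be a 2-connected o-heavy graph on n vertices. Suppose that for every induced copy of Z_2 in G, with triangle vertices a_1, a_2, a_3 and attached path a_1 b_1 c_1, each of the two pairs {a_2, b_1} and {a_3, b_1} satisfies max{deg(u), deg(v)} ≥ n/2 or |N(u) ∩ N(v)| ≥ 2. Then G is Hamiltonian. -/

import Mathlib

open SimpleGraph

/-- `G` is 2-connected: at least 3 vertices and deleting any single vertex leaves
a connected graph. -/
def TwoConnected {V : Type*} [Fintype V] (G : SimpleGraph V) : Prop :=
  3 ≤ Fintype.card V ∧ ∀ v : V, (G.induce {w | w ≠ v}).Connected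

/-- `c, a, b, d` form an induced claw (`K_{1,3}`) in `G` with center `c` and
end-vertices `a`, `b`, `d`. -/
def IsInducedClaw {V : Type*} (G : SimpleGraph V) (c a b d : V) : Prop :=
  a ≠ b ∧ a ≠ d ∧ b ≠ d ∧
  G.Adj c a ∧ G.Adj c b ∧ G.Adj c d ∧
  ¬G.Adj a b ∧ ¬G.Adj a d ∧ ¬G.Adj b d

/-- `a₁, a₂, a₃, b₁` form an induced copy of `Z₁` in `G`: triangle `a₁a₂a₃` with
pendant edge `a₁b₁`. -/
def IsInducedZ1 {V : Type*} (G : SimpleGraph V) (a1 a2 a3 b1 : V) : Prop :=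
  G.Adj a1 a2 ∧ G.Adj a1 a3 ∧ G.Adj a2 a3 ∧ G.Adj a1 b1 ∧
  b1 ≠ a2 ∧ b1 ≠ a3 ∧ ¬G.Adj b1 a2 ∧ ¬G.Adj b1 a3

/-- `a₁, a₂, a₃, b₁, c₁` form an induced copy of `Z₂` in `G`: triangle `a₁a₂a₃`
with path `a₁b₁c₁` attached at `a₁`. -/
def IsInducedZ2 {V : Type*} (G : SimpleGraph V) (a1 a2 a3 b1 c1 : V) : Prop :=
  G.Adj a1 a2 ∧ G.Adj a1 a3 ∧ G.Adj a2 a3 ∧ G.Adj a1 b1 ∧ G.Adj b1 c1 ∧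
  b1 ≠ a2 ∧ b1 ≠ a3 ∧ c1 ≠ a1 ∧ c1 ≠ a2 ∧ c1 ≠ a3 ∧
  ¬G.Adj b1 a2 ∧ ¬G.Adj b1 a3 ∧ ¬G.Adj c1 a1 ∧ ¬G.Adj c1 a2 ∧ ¬G.Adj c1 a3
/-- A vertex is heavy if its degree is at least `n/2`. -/
def Heavy {V : Type*} [Fintype V] (G : SimpleGraph V) [DecidableRel G.Adj] (v : V) : Prop :=
  Fintype.card V ≤ 2 * G.degree v

/-- `G` is 1-heavy: every induced claw has at least one heavy end-vertex. -/
def OneHeavy {V : Type*} [Fintype V] (G : SimpleGraph V) [DecidableRel G.Adj] : Prop :=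
  ∀ c a b d : V, IsInducedClaw G c a b d → Heavy G a ∨ Heavy G b ∨ Heavy G d

/-- `G` is 2-heavy: every induced claw has at least two heavy end-vertices. -/
def TwoHeavy {V : Type*} [Fintype V] (G : SimpleGraph V) [DecidableRel G.Adj] : Prop :=
  ∀ c a b d : V, IsInducedClaw G c a b d →
    (Heavy G a ∧ Heavy G b) ∨ (Heavy G a ∧ Heavy G d) ∨ (Heavy G b ∧ Heavy G d)

/-- `G` is o-heavy: every induced claw has two end-vertices with degree sum
at least `n`. -/
def OHeavy {V : Type*} [Fintype V] (G : SimpleGraph V) [DecidableRel G.Adj] : Prop :=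
  ∀ c a b d : V, IsInducedClaw G c a b d →
    Fintype.card V ≤ G.degree a + G.degree b ∨
    Fintype.card V ≤ G.degree a + G.degree d ∨
    Fintype.card V ≤ G.degree b + G.degree d

/-- The pair `u, v` satisfies Fan's condition (`max{d(u),d(v)} ≥ n/2`) or Shi's
condition (`|N(u) ∩ N(v)| ≥ 2`). -/
def FanOrShi {V : Type*} [Fintype V] [DecidableEq V]
    (G : SimpleGraph V) [DecidableRel G.Adj] (u v : V) : Prop :=
  Fintype.card V ≤ 2 * G.degree u ∨ Fintype.card V ≤ 2 * G.degree v ∨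
  2 ≤ (G.neighborFinset u ∩ G.neighborFinset v).card

/-- `PathOn G a b s`: there is a path of `G` from `a` to `b` with vertex set exactly `s`. -/
inductive PathOn {V : Type*} [DecidableEq V] (G : SimpleGraph V) : V → V → Finset V → Prop
  | single (a : V) : PathOn G a a {a}
  | cons {a b c : V} {s : Finset V} (hab : G.Adj a b) (ha : a ∉ s) (hp : PathOn G b c s) :
      PathOn G a c (insert a s)

/-- `CycleOn G s`: there is a cycle of `G` with vertex set exactly `s`. -/
def CycleOn {V : Type*} [DecidableEq V] (G : SimpleGraph V) (s : Finset V) : Prop :=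
  3 ≤ s.card ∧ ∃ a b, PathOn G a b s ∧ G.Adj b a

namespace PathOn

variable {V : Type*} [DecidableEq V] {G K : SimpleGraph V} {a b c d x : V} {s t : Finset V}

lemma left_mem (h : PathOn G a b s) : a ∈ s := by
  cases h <;> simp

lemma right_mem (h : PathOn G a b s) : b ∈ s := by
  induction h with
  | single => simp
  | cons _ _ _ ih => exact Finset.mem_insert_of_mem ih

lemma mono (hGK : G ≤ K) (h : PathOn G a b s) : PathOn K a b s := by
  induction h with
  | single a => exact .single a
  | cons hab ha _ ih => exact .cons (hGK hab) ha ih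

lemma append (h : PathOn G a b s) (h' : PathOn G c d t) (hbc : G.Adj b c) (hst : Disjoint s t) :
    PathOn G a d (s ∪ t) := by
  induction h with
  | single a =>
    exact .cons hbc (by simpa using hst) h'
  | cons hab ha _ ih =>
    rw [Finset.disjoint_insert_left] at hst
    rw [Finset.insert_union]
    exact .cons hab (by simp [ha, hst.1]) (ih hbc hst.2)

lemma reverse (h : PathOn G a b s) : PathOn G b a s := by
  induction h with
  | single a => exact .single a
  | @cons a b c s hab ha _ ih =>
    have := ih.append (.single a) hab.symm (by simpa using ha)
    rwa [Finset.union_comm, ← Finset.insert_eq] at this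

lemma eq_single_or_exists_cons (h : PathOn G a b s) :
    (a = b ∧ s = {a}) ∨
      ∃ c t, G.Adj a c ∧ PathOn G c b t ∧ a ∉ t ∧ s = insert a t := by
  cases h with
  | single => exact .inl ⟨rfl, rfl⟩
  | cons hab ha hp => exact .inr ⟨_, _, hab, hp, ha, rfl⟩

lemma eq_singleton (h : PathOn G a a s) : s = {a} := by
  rcases h.eq_single_or_exists_cons with h | ⟨c, t, -, hp, ha, -⟩
  · exact h.2
  · exact absurd hp.right_mem ha

lemma exists_split (h : PathOn G a b s) (hx : x ∈ s) (hxa : x ≠ a) :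
    ∃ y t t', PathOn G a y t ∧ G.Adj y x ∧ PathOn G x b t' ∧ Disjoint t t' ∧ s = t ∪ t' := by
  induction h with
  | single a => simp at hx; exact absurd hx hxa
  | @cons a b c s hab ha hp ih =>
    by_cases hxb : x = b
    · subst hxb
      exact ⟨a, {a}, s, .single a, hab, hp, by simpa using ha, Finset.insert_eq _ _⟩
    · obtain ⟨y, t, t', h₁, h₂, h₃, h₄, rfl⟩ :=
        ih ((Finset.mem_insert.1 hx).resolve_left hxa) hxb
      simp only [Finset.mem_union, not_or] at ha
      exact ⟨y, insert a t, t', .cons hab ha.1 h₁, h₂, h₃,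
        by simp [Finset.disjoint_insert_left, ha.2, h₄], by simp⟩

/-- A path either avoids the edge `cd` or consists of two paths avoiding it, joined by it. -/
lemma deleteEdge_or_exists_split (h : PathOn G a b s) (c d : V) :
    PathOn (G.deleteEdges {s(c, d)}) a b s ∨
      ∃ c' d' t t', s(c', d') = s(c, d) ∧ PathOn (G.deleteEdges {s(c, d)}) a c' t ∧
        PathOn (G.deleteEdges {s(c, d)}) d' b t' ∧ Disjoint t t' ∧ s = t ∪ t' := by
  induction h with
  | single a => exact .inl (.single a)
  | @cons a e b s hae ha hp ih =>
    rcases ih with ih | ⟨c', d', t, t', he, h₁, h₂, h₃, rfl⟩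
    · by_cases he : s(a, e) = s(c, d)
      · exact .inr ⟨a, e, {a}, s, he, .single a, ih, by simpa using ha,
          Finset.insert_eq _ _⟩
      · exact .inl (.cons (by simp [deleteEdges_adj, hae, he]) ha ih)
    · simp only [Finset.mem_union, not_or] at ha
      have hc : a ≠ c' := fun h => ha.1 (h ▸ h₁.right_mem)
      have hd : a ≠ d' := fun h => ha.2 (h ▸ h₂.left_mem)
      refine .inr ⟨c', d', insert a t, t', he, .cons ?_ ha.1 h₁, h₂,
        by simp [Finset.disjoint_insert_left, ha.2, h₃], by simp⟩
      rw [deleteEdges_adj, ← he]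
      refine ⟨hae, ?_⟩
      simp only [Set.mem_singleton_iff, Sym2.eq_iff]
      tauto

lemma exists_isPath (h : PathOn G a b s) :
    ∃ p : G.Walk a b, p.IsPath ∧ ∀ y, y ∈ p.support ↔ y ∈ s := by
  induction h with
  | single a => exact ⟨.nil, by simp, by simp⟩
  | cons hab ha _ ih =>
    obtain ⟨p, hp, hs⟩ := ih
    exact ⟨.cons hab p, by simp [Walk.cons_isPath_iff, hp, hs, ha], by simp [hs]⟩

lemma of_isPath (p : G.Walk a b) (hp : p.IsPath) : PathOn G a b p.support.toFinset := by
  induction p with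
  | nil => simpa using PathOn.single _
  | cons h p ih =>
    rw [Walk.cons_isPath_iff] at hp
    simpa using PathOn.cons h (by simpa using hp.2) (ih hp.1)

lemma exists_of_reachable (h : G.Reachable a b) : ∃ s, PathOn G a b s := by
  obtain ⟨p⟩ := h
  exact ⟨_, of_isPath _ p.bypass_isPath⟩

/-- The counting step of Ore's argument: a path to `v` can be cut at consecutive vertices
`i, j` with `v ~ i` and `u ~ j`, or `u` and `v` have few neighbours on it. -/
lemma exists_crossing_or_card_le [DecidableRel K.Adj] (u : V) (h : PathOn G a b s) :
    (∃ i j t t', PathOn G a i t ∧ PathOn G j b t' ∧ Disjoint t t' ∧ s = t ∪ t' ∧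
      K.Adj b i ∧ K.Adj u j) ∨
    (s.filter (K.Adj u)).card + (s.filter (K.Adj b)).card + 1
      ≤ s.card + if K.Adj u a then 1 else 0 := by
  induction h with
  | single a =>
    right
    simp only [Finset.filter_singleton, SimpleGraph.irrefl, Finset.card_singleton]
    split_ifs <;> simp_all
  | @cons a c b s hac ha hp ih =>
    rcases ih with ⟨i, j, t, t', h₁, h₂, h₃, rfl, h₄⟩ | ih
    · simp only [Finset.mem_union, not_or] at ha
      exact .inl ⟨i, j, insert a t, t', .cons hac ha.1 h₁, h₂,
        by simp [Finset.disjoint_insert_left, ha.2, h₃], by simp, h₄⟩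
    · by_cases hx : K.Adj b a ∧ K.Adj u c
      · exact .inl ⟨a, c, {a}, s, .single a, hp, by simpa using ha,
          Finset.insert_eq _ _, hx⟩
      · right
        have h₁ : ∀ r : V, ((insert a s).filter (K.Adj r)).card
            = (s.filter (K.Adj r)).card + if K.Adj r a then 1 else 0 := by
          intro r
          rw [Finset.filter_insert]
          split_ifs with hr
          · rw [Finset.card_insert_of_notMem (by simp [ha])]
          · rfl
        rw [h₁, h₁, Finset.card_insert_of_notMem ha]
        split_ifs at * <;> first | omega | tauto

end PathOn

section Cycles

variable {V : Type*} [DecidableEq V] {G : SimpleGraph V} {s : Finset V}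

lemma CycleOn.exists_pathOn_adj (h : CycleOn G s) {u : V} (hu : u ∈ s) :
    ∃ q, PathOn G u q s ∧ G.Adj q u := by
  obtain ⟨-, a, b, hp, hba⟩ := h
  by_cases hua : u = a
  · subst hua; exact ⟨b, hp, hba⟩
  · obtain ⟨y, t, t', h₁, h₂, h₃, h₄, rfl⟩ := hp.exists_split hu hua
    exact ⟨y, by simpa [Finset.union_comm] using h₃.append h₁ hba h₄.symm, h₂⟩

/-- Opening a cycle at one of its vertices. -/
lemma CycleOn.exists_pathOn_erase (h : CycleOn G s) {u : V} (hu : u ∈ s) :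
    ∃ p q, PathOn G p q (s.erase u) ∧ G.Adj u p ∧ G.Adj u q := by
  obtain ⟨q, hp, hq⟩ := h.exists_pathOn_adj hu
  rcases hp.eq_single_or_exists_cons with ⟨rfl, -⟩ | ⟨p, t, hup, hp', hut, rfl⟩
  · exact absurd hq (G.loopless.irrefl _)
  · exact ⟨p, q, by simpa [hut] using hp', hup, hq.symm⟩

lemma CycleOn.isHamiltonian [Fintype V] (h : CycleOn G (Finset.univ : Finset V)) :
    G.IsHamiltonian := by
  intro _
  obtain ⟨h3, a, b, hp, hba⟩ := h
  obtain ⟨p, hp, hs⟩ := hp.exists_isPath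
  refine ⟨b, .cons hba p, ?_⟩
  rw [Walk.isHamiltonianCycle_iff_isCycle_and_support_count_tail_eq_one]
  refine ⟨?_, fun v => ?_⟩
  · rw [Walk.cons_isCycle_iff]
    refine ⟨hp, fun he => ?_⟩
    cases p with
    | nil => exact G.loopless.irrefl _ hba
    | @cons _ c _ hac p =>
      rw [Walk.cons_isPath_iff] at hp
      rw [Walk.edges_cons, List.mem_cons] at he
      rcases he with he | he
      · have hbc : c = b := by
          rw [Sym2.eq_iff] at he
          rcases he with he | he
          · exact absurd he.1 hba.ne
          · exact he.1.symm
        subst hbc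
        have := Walk.isPath_iff_nil.1 hp.1
        rw [← Walk.eq_nil_iff_nil] at this
        subst this
        have : (Finset.univ : Finset V) ⊆ {a, c} := fun y hy => by
          have := (hs y).2 hy
          simpa using this
        have := Finset.card_le_card this
        have := Finset.card_le_two (a := a) (b := c)
        omega
      · exact hp.2 (p.snd_mem_support_of_mem_edges he)
  · rw [Walk.support_cons, List.tail_cons]
    exact List.count_eq_one_of_mem hp.support_nodup ((hs v).2 (Finset.mem_univ v))

end Cycles

section ClosureGraph

variable {V : Type*} [Fintype V]

/-- The graph whose edges are the edges of `G` together with all pairs of vertices whose degree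
sum in `G` is at least the order of `G`. -/
def oGraph (G : SimpleGraph V) [DecidableRel G.Adj] : SimpleGraph V where
  Adj a b := a ≠ b ∧ (G.Adj a b ∨ Fintype.card V ≤ G.degree a + G.degree b)
  symm := ⟨fun a b h => ⟨h.1.symm, h.2.imp (fun h => h.symm) (fun h => by omega)⟩⟩
  loopless := ⟨fun _ h => h.1 rfl⟩

variable {G : SimpleGraph V} [DecidableRel G.Adj]

lemma le_oGraph : G ≤ oGraph G := fun _ _ h => ⟨h.ne, .inl h⟩

lemma oGraph_adj_of_heavy {a b : V} (hab : a ≠ b) (ha : Heavy G a) (hb : Heavy G b) :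
    (oGraph G).Adj a b :=
  ⟨hab, .inr (by unfold Heavy at ha hb; omega)⟩

variable [DecidableEq V] {K : SimpleGraph V} {s : Finset V}

lemma cycleOn_or_exists_cycleOn_insert (hGK : G ≤ K) {u v : V} (hp : PathOn K u v s)
    (hd : Fintype.card V ≤ G.degree u + G.degree v) (hs : 3 ≤ s.card) :
    CycleOn K s ∨ ∃ z ∉ s, CycleOn K (insert z s) := by
  by_cases hz : ∃ z ∉ s, G.Adj u z ∧ G.Adj v z
  · obtain ⟨z, hzs, hu, hv⟩ := hz
    refine .inr ⟨z, hzs, ?_, z, v, .cons (hGK hu.symm) hzs hp, hGK hv⟩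
    rw [Finset.card_insert_of_notMem hzs]
    omega
  · left
    rcases hp.exists_crossing_or_card_le (K := G) u with
      ⟨i, j, t, t', h₁, h₂, h₃, rfl, hi, hj⟩ | hle
    · exact ⟨hs, u, j, h₁.append h₂.reverse (hGK hi.symm) h₃, hGK hj.symm⟩
    · exfalso
      rw [if_neg (G.loopless.irrefl _)] at hle
      have hdeg : ∀ r, G.degree r
          = (s.filter (G.Adj r)).card + (sᶜ.filter (G.Adj r)).card := by
        intro r
        rw [← card_neighborFinset_eq_degree, neighborFinset_eq_filter,
          ← Finset.card_union_of_disjoint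
            (Finset.disjoint_filter_filter disjoint_compl_right), ← Finset.filter_union,
          Finset.union_compl]
      have hdis : Disjoint (sᶜ.filter (G.Adj u)) (sᶜ.filter (G.Adj v)) := by
        rw [Finset.disjoint_left]
        intro z hzu hzv
        simp only [Finset.mem_filter, Finset.mem_compl] at hzu hzv
        exact hz ⟨z, hzu.1, hzu.2, hzv.2⟩
      have hout : (sᶜ.filter (G.Adj u)).card + (sᶜ.filter (G.Adj v)).card ≤ sᶜ.card := by
        rw [← Finset.card_union_of_disjoint hdis]
        exact Finset.card_le_card
          (Finset.union_subset (Finset.filter_subset _ _) (Finset.filter_subset _ _))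
      have := Finset.card_add_card_compl s
      have := hdeg u
      have := hdeg v
      omega

/-- If the vertex set of a cycle of `oGraph G` cannot be enlarged, it carries a cycle of `G`. -/
lemma CycleOn.of_oGraph (h : CycleOn (oGraph G) s)
    (hmax : ∀ t, CycleOn (oGraph G) t → s ⊆ t → t = s) : CycleOn G s := by
  obtain ⟨K, hK⟩ := Set.Finite.exists_minimal
    (s := {K : SimpleGraph V | G ≤ K ∧ K ≤ oGraph G ∧ CycleOn K s}) (Set.toFinite _)
    ⟨oGraph G, le_oGraph, le_rfl, h⟩
  obtain ⟨⟨hGK, hKH, h3, a, b, hp, hba⟩, hmin⟩ := hK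
  suffices hKG : K ≤ G from (le_antisymm hKG hGK) ▸ ⟨h3, a, b, hp, hba⟩
  intro c d hcd
  by_contra hG
  set L := K.deleteEdges {s(c, d)} with hL
  have hGL : G ≤ L := fun i j hij => by
    rw [hL, deleteEdges_adj]
    refine ⟨hGK hij, fun he => hG ?_⟩
    rw [Set.mem_singleton_iff, Sym2.eq_iff] at he
    rcases he with ⟨rfl, rfl⟩ | ⟨rfl, rfl⟩
    exacts [hij, hij.symm]
  have hLK : L ≤ K := deleteEdges_le _
  have hLs : ¬CycleOn L s := fun hc => by
    have := hmin ⟨hGL, hLK.trans hKH, hc⟩ hLK hcd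
    simp [hL, deleteEdges_adj] at this
  have key : ∃ u v, s(u, v) = s(c, d) ∧ PathOn L u v s := by
    by_cases he : s(b, a) = s(c, d)
    · rcases hp.deleteEdge_or_exists_split c d with h | ⟨c', d', t, t', he', h₁, h₂, h₃, rfl⟩
      · exact ⟨a, b, by rw [← he, Sym2.eq_swap], h⟩
      · exfalso
        rw [← he, Sym2.eq_iff] at he'
        rcases he' with ⟨rfl, rfl⟩ | ⟨rfl, rfl⟩
        · exact Finset.disjoint_left.1 h₃ h₁.right_mem h₂.right_mem
        · rw [h₁.eq_singleton, h₂.eq_singleton] at h3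
          have := Finset.card_union_le {c'} {d'}
          simp only [Finset.card_singleton] at this
          omega
    · have hbaL : L.Adj b a := by rw [hL, deleteEdges_adj]; exact ⟨hba, he⟩
      rcases hp.deleteEdge_or_exists_split c d with h | ⟨c', d', t, t', he', h₁, h₂, h₃, rfl⟩
      · exact absurd ⟨h3, a, b, h, hbaL⟩ hLs
      · exact ⟨d', c', by rw [← he', Sym2.eq_swap],
          by simpa [Finset.union_comm] using h₂.append h₁ hbaL h₃.symm⟩
  obtain ⟨u, v, he, hp⟩ := key
  have huv : ¬G.Adj u v ∧ (oGraph G).Adj u v := by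
    rw [Sym2.eq_iff] at he
    rcases he with ⟨rfl, rfl⟩ | ⟨rfl, rfl⟩
    exacts [⟨hG, hKH hcd⟩, ⟨fun h => hG h.symm, (hKH hcd).symm⟩]
  rcases cycleOn_or_exists_cycleOn_insert hGL hp (huv.2.2.resolve_left huv.1) h3 with
    h | ⟨z, hz, -, i, j, hij, hji⟩
  · exact hLs h
  · have := hmax (insert z s)
      ⟨h3.trans (Finset.card_le_card (Finset.subset_insert _ _)), i, j,
        hij.mono (hLK.trans hKH), hKH (hLK hji)⟩ (Finset.subset_insert _ _)
    exact hz (this ▸ Finset.mem_insert_self z s)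

end ClosureGraph

section Extremal

variable {V : Type*} [DecidableEq V]

/-- `u` is a vertex of `S` with a neighbour in `R`. -/
def IsAttachment (G : SimpleGraph V) (S : Finset V) (R : Set V) (u : V) : Prop :=
  u ∈ S ∧ ∃ x ∈ R, G.Adj u x

/-- The cycle `u p … a v b … q` of `G` with vertex set `S`, where `s₁` and `s₂` are the vertex
sets of the paths `p … a` and `b … q`. -/
structure IsSplitCycle (G : SimpleGraph V) (S : Finset V) (u v p a b q : V)
    (s₁ s₂ : Finset V) : Prop where
  adj_up : G.Adj u p
  adj_uq : G.Adj u q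
  adj_va : G.Adj v a
  adj_vb : G.Adj v b
  path₁ : PathOn G p a s₁
  path₂ : PathOn G b q s₂
  ne : u ≠ v
  notMem_u₁ : u ∉ s₁
  notMem_u₂ : u ∉ s₂
  notMem_v₁ : v ∉ s₁
  notMem_v₂ : v ∉ s₂
  disjoint : Disjoint s₁ s₂
  eq : S = insert u (insert v (s₁ ∪ s₂))

variable {G : SimpleGraph V} {S : Finset V} {R : Set V} {u v p a b q x : V} {s₁ s₂ : Finset V}

namespace IsSplitCycle

lemma reverse (h : IsSplitCycle G S u v p a b q s₁ s₂) :
    IsSplitCycle G S u v q b a p s₂ s₁ where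
  adj_up := h.adj_uq
  adj_uq := h.adj_up
  adj_va := h.adj_vb
  adj_vb := h.adj_va
  path₁ := h.path₂.reverse
  path₂ := h.path₁.reverse
  ne := h.ne
  notMem_u₁ := h.notMem_u₂
  notMem_u₂ := h.notMem_u₁
  notMem_v₁ := h.notMem_v₂
  notMem_v₂ := h.notMem_v₁
  disjoint := h.disjoint.symm
  eq := by rw [h.eq, Finset.union_comm]

lemma rotate (h : IsSplitCycle G S u v p a b q s₁ s₂) :
    IsSplitCycle G S v u b q p a s₂ s₁ where
  adj_up := h.adj_vb
  adj_uq := h.adj_va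
  adj_va := h.adj_uq
  adj_vb := h.adj_up
  path₁ := h.path₂
  path₂ := h.path₁
  ne := h.ne.symm
  notMem_u₁ := h.notMem_v₂
  notMem_u₂ := h.notMem_v₁
  notMem_v₁ := h.notMem_u₂
  notMem_v₂ := h.notMem_u₁
  disjoint := h.disjoint.symm
  eq := by rw [h.eq, Finset.union_comm, Finset.insert_comm]

lemma p_mem (h : IsSplitCycle G S u v p a b q s₁ s₂) : p ∈ S := by
  simp [h.eq, h.path₁.left_mem]

lemma q_mem (h : IsSplitCycle G S u v p a b q s₁ s₂) : q ∈ S := by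
  simp [h.eq, h.path₂.right_mem]

lemma p_ne_b (h : IsSplitCycle G S u v p a b q s₁ s₂) : p ≠ b := fun e =>
  Finset.disjoint_left.1 h.disjoint h.path₁.left_mem (e ▸ h.path₂.left_mem)

lemma p_ne_q (h : IsSplitCycle G S u v p a b q s₁ s₂) : p ≠ q := fun e =>
  Finset.disjoint_left.1 h.disjoint h.path₁.left_mem (e ▸ h.path₂.right_mem)

lemma p_ne_v (h : IsSplitCycle G S u v p a b q s₁ s₂) : p ≠ v := fun e =>
  h.notMem_v₁ (e ▸ h.path₁.left_mem)

lemma pathOn_erase (h : IsSplitCycle G S u v p a b q s₁ s₂) : PathOn G p q (S.erase u) := by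
  have h₁ := (PathOn.single v).append h.path₂ h.adj_vb (by simpa using h.notMem_v₂)
  have h₂ := h.path₁.append h₁ h.adj_va.symm
    (by simp [h.notMem_v₁, h.disjoint])
  convert h₂ using 1
  rw [h.eq, Finset.erase_insert (by simp [h.ne, h.notMem_u₁, h.notMem_u₂])]
  ext; simp

end IsSplitCycle

lemma PathOn.exists_isSplitCycle (hp : PathOn G p q (S.erase u)) (hu : u ∈ S)
    (hup : G.Adj u p) (huq : G.Adj u q) (hv : v ∈ S) (hvu : v ≠ u) (hvp : v ≠ p) (hvq : v ≠ q) :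
    ∃ a b s₁ s₂, IsSplitCycle G S u v p a b q s₁ s₂ := by
  obtain ⟨a, s₁, t, h₁, hav, h₂, h₃, h₄⟩ := hp.exists_split (Finset.mem_erase.2 ⟨hvu, hv⟩) hvp
  obtain ⟨rfl, -⟩ | ⟨b, s₂, hvb, h₅, hvs, rfl⟩ := h₂.eq_single_or_exists_cons
  · exact absurd rfl hvq
  have hu' : u ∉ s₁ ∪ insert v s₂ := h₄ ▸ Finset.notMem_erase u S
  simp only [Finset.mem_union, Finset.mem_insert, not_or] at hu'
  rw [Finset.disjoint_insert_right] at h₃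
  exact ⟨a, b, s₁, s₂, hup, huq, hav.symm, hvb, h₁, h₅, hvu.symm, hu'.1, hu'.2.2, h₃.1, hvs, h₃.2,
    by rw [← Finset.insert_erase hu, h₄, Finset.union_insert]⟩

variable [Fintype V]

/-- `S` is the vertex set of a cycle of `oGraph G` which contains all heavy vertices and cannot
be enlarged, and `R` is a connected component of `G - S`. -/
structure IsExtremal (G : SimpleGraph V) [DecidableRel G.Adj] (S : Finset V) (R : Set V) :
    Prop where
  cycleOn : CycleOn (oGraph G) S
  maximal : ∀ t, CycleOn (oGraph G) t → S ⊆ t → t = S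
  heavy_mem : ∀ v, Heavy G v → v ∈ S
  notMem : ∀ x ∈ R, x ∉ S
  connected : ∀ x ∈ R, ∀ y ∈ R, ∃ t, PathOn G x y t ∧ Disjoint t S
  closed : ∀ x ∈ R, ∀ y, G.Adj x y → y ∈ R ∨ y ∈ S

variable [DecidableRel G.Adj]

namespace IsExtremal

lemma false_of_pathOn (hE : IsExtremal G S R) {i j : V} {t r : Finset V}
    (hp : PathOn (oGraph G) i j r) (hji : (oGraph G).Adj j i) (hr : r = S ∪ t)
    (ht : Disjoint t S) (hx : x ∈ t) : False := by
  subst hr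
  have h := hE.maximal _ ⟨hE.cycleOn.1.trans (Finset.card_le_card Finset.subset_union_left),
    i, j, hp, hji⟩ Finset.subset_union_left
  exact Finset.disjoint_left.1 ht hx (h ▸ Finset.mem_union_right S hx)

lemma exists_path_of_isAttachment (hE : IsExtremal G S R) (hu : IsAttachment G S R u)
    (hv : IsAttachment G S R v) :
    ∃ x y t, x ∈ R ∧ G.Adj u x ∧ G.Adj v y ∧ PathOn (oGraph G) x y t ∧ Disjoint t S := by
  obtain ⟨-, x, hx, hux⟩ := hu
  obtain ⟨-, y, hy, hvy⟩ := hv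
  obtain ⟨t, ht, htS⟩ := hE.connected x hx y hy
  exact ⟨x, y, t, hx, hux, hvy, ht.mono le_oGraph, htS⟩

/-- No neighbour of an attachment along the cycle is joined to the component. -/
lemma not_adj_component (hE : IsExtremal G S R) (hu : IsAttachment G S R u)
    (hp : PathOn G p q (S.erase u)) (huq : G.Adj u q) (hx : x ∈ R) : ¬(oGraph G).Adj p x := by
  intro hpx
  obtain ⟨huS, y, hy, huy⟩ := hu
  obtain ⟨t, ht, htS⟩ := hE.connected y hy x hx
  have hut : u ∉ t := fun h => Finset.disjoint_left.1 htS h huS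
  have h₁ := (hp.mono le_oGraph).append (.single u) (le_oGraph huq.symm) (by simp)
  have h₂ := h₁.append (ht.mono le_oGraph) (le_oGraph huy) (by
    rw [Finset.disjoint_union_left]
    exact ⟨(htS.mono_right (Finset.erase_subset _ _)).symm, by simpa using hut⟩)
  refine hE.false_of_pathOn h₂ hpx.symm ?_ htS ht.left_mem
  rw [Finset.union_comm (S.erase u), ← Finset.insert_eq, Finset.insert_erase huS]

lemma not_isAttachment (hE : IsExtremal G S R) (hu : IsAttachment G S R u)
    (hp : PathOn G p q (S.erase u)) (huq : G.Adj u q) : ¬IsAttachment G S R p := by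
  rintro ⟨-, x, hx, hpx⟩
  exact hE.not_adj_component hu hp huq hx (le_oGraph hpx)

/-- The two neighbours of an attachment along the cycle are joined in `oGraph G`. -/
lemma adj_pq (hE : IsExtremal G S R) (hO : OHeavy G) (hu : IsAttachment G S R u)
    (h : IsSplitCycle G S u v p a b q s₁ s₂) : (oGraph G).Adj p q := by
  refine ⟨h.p_ne_q, ?_⟩
  by_contra! hn
  obtain ⟨huS, x, hx, hux⟩ := hu
  have hu : IsAttachment G S R u := ⟨huS, x, hx, hux⟩
  have hpx := hE.not_adj_component hu h.pathOn_erase h.adj_uq hx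
  have hqx := hE.not_adj_component hu h.reverse.pathOn_erase h.adj_up hx
  have hpx' : p ≠ x := fun e => hE.notMem x hx (e ▸ h.p_mem)
  have hqx' : q ≠ x := fun e => hE.notMem x hx (e ▸ h.q_mem)
  rcases hO u p q x ⟨h.p_ne_q, hpx', hqx', h.adj_up, h.adj_uq, hux, hn.1,
    fun e => hpx (le_oGraph e), fun e => hqx (le_oGraph e)⟩ with hd | hd | hd
  · omega
  · exact hpx ⟨hpx', .inr hd⟩
  · exact hqx ⟨hqx', .inr hd⟩

lemma not_adj_pv (hE : IsExtremal G S R) (hO : OHeavy G) (hu : IsAttachment G S R u)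
    (hv : IsAttachment G S R v) (h : IsSplitCycle G S u v p a b q s₁ s₂) :
    ¬(oGraph G).Adj p v := by
  intro hpv
  obtain ⟨x, y, t, -, hux, hvy, ht, htS⟩ := hE.exists_path_of_isAttachment hu hv
  have hS := htS
  rw [h.eq] at hS
  simp only [Finset.disjoint_insert_right, Finset.disjoint_union_right] at hS
  have h₁ := (h.path₂.mono le_oGraph).append (.single u) (le_oGraph h.adj_uq.symm)
    (by simpa using h.notMem_u₂)
  have h₂ := h₁.append ht (le_oGraph hux) (by
    simp [hS, hS.2.2.2.symm])
  have h₃ := h₂.append (.single v) (le_oGraph hvy.symm) (by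
    simp [hS, h.notMem_v₂, h.ne.symm])
  have h₄ := h₃.append (h.path₁.mono le_oGraph) hpv.symm (by
    simp [Finset.disjoint_union_left, hS, h.disjoint.symm, h.notMem_u₁, h.notMem_v₁])
  refine hE.false_of_pathOn h₄ (hE.adj_pq hO hv h.rotate).symm ?_ htS ht.left_mem
  rw [h.eq]; ext; simp; tauto

lemma not_adj_pb (hE : IsExtremal G S R) (hu : IsAttachment G S R u)
    (hv : IsAttachment G S R v) (h : IsSplitCycle G S u v p a b q s₁ s₂) :
    ¬(oGraph G).Adj p b := by
  intro hpb
  obtain ⟨x, y, t, -, hux, hvy, ht, htS⟩ := hE.exists_path_of_isAttachment hu hv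
  have hS := htS
  rw [h.eq] at hS
  simp only [Finset.disjoint_insert_right, Finset.disjoint_union_right] at hS
  have h₁ := (h.path₂.mono le_oGraph).append (.single u) (le_oGraph h.adj_uq.symm)
    (by simpa using h.notMem_u₂)
  have h₂ := h₁.append ht (le_oGraph hux) (by
    simp [hS, hS.2.2.2.symm])
  have h₃ := h₂.append (.single v) (le_oGraph hvy.symm) (by
    simp [hS, h.notMem_v₂, h.ne.symm])
  have h₄ := h₃.append (h.path₁.reverse.mono le_oGraph) (le_oGraph h.adj_va) (by
    simp [Finset.disjoint_union_left, hS, h.disjoint.symm, h.notMem_u₁, h.notMem_v₁])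
  refine hE.false_of_pathOn h₄ hpb ?_ htS ht.left_mem
  rw [h.eq]; ext; simp; tauto

/-- The successor of `p` on the cycle is not adjacent to the other attachment `v`. -/
lemma not_adj_succ (hE : IsExtremal G S R) (hO : OHeavy G) (hu : IsAttachment G S R u)
    (hv : IsAttachment G S R v) (h : IsSplitCycle G S u v p a b q s₁ s₂) {w : V}
    {s : Finset V} (hw : PathOn G w a s) (hps : p ∉ s) (hs : s₁ = insert p s) :
    ¬G.Adj w v := by
  intro hwv
  subst hs
  obtain ⟨x, y, t, -, hux, hvy, ht, htS⟩ := hE.exists_path_of_isAttachment hu hv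
  have hS := htS
  rw [h.eq] at hS
  simp only [Finset.disjoint_insert_right, Finset.disjoint_union_right] at hS
  have hu₁ := h.notMem_u₁
  have hv₁ := h.notMem_v₁
  have hd := h.disjoint
  simp only [Finset.mem_insert, not_or, Finset.disjoint_insert_left] at hu₁ hv₁ hd
  have h₁ := (PathOn.single p).append (.single u) (le_oGraph h.adj_up.symm)
    (by simpa using Ne.symm hu₁.1)
  have h₂ := h₁.append ht (le_oGraph hux) (by
    simp [hS])
  have h₃ := h₂.append (.single v) (le_oGraph hvy.symm) (by
    simp [hS, hv₁.1, h.ne.symm])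
  have h₄ := h₃.append (hw.mono le_oGraph) (le_oGraph hwv.symm) (by
    simp [hS, hps, hu₁, hv₁])
  have h₅ := h₄.append (h.path₂.mono le_oGraph) (hE.adj_pq hO hv h.rotate).symm (by
    simp [Finset.disjoint_union_left, hS, hd, h.notMem_u₂, h.notMem_v₂])
  refine hE.false_of_pathOn h₅ (hE.adj_pq hO hu h).symm ?_ htS ht.left_mem
  rw [h.eq]; ext; simp; tauto

lemma not_adj_isAttachment (hE : IsExtremal G S R) (hO : OHeavy G) (hu : IsAttachment G S R u)
    (hp : PathOn G p q (S.erase u)) (hup : G.Adj u p) (huq : G.Adj u q)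
    (hv : IsAttachment G S R v) (hvu : v ≠ u) : ¬(oGraph G).Adj p v := by
  have hvp : v ≠ p := fun e => hE.not_isAttachment hu hp huq (e ▸ hv)
  have hvq : v ≠ q := fun e => hE.not_isAttachment hu hp.reverse hup (e ▸ hv)
  obtain ⟨a, b, s₁, s₂, h⟩ := hp.exists_isSplitCycle hu.1 hup huq hv.1 hvu hvp hvq
  exact hE.not_adj_pv hO hu hv h

lemma heavy_of_fanOrShi (hE : IsExtremal G S R) (hO : OHeavy G) (hu : IsAttachment G S R u)
    (hp : PathOn G p q (S.erase u)) (hup : G.Adj u p) (huq : G.Adj u q) (hx : x ∈ R)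
    (h : FanOrShi G p x) : Heavy G p := by
  rcases h with h | h | h
  · exact h
  · exact absurd (hE.heavy_mem x h) (hE.notMem x hx)
  · exfalso
    obtain ⟨z, hz, hzu⟩ := Finset.exists_mem_ne h u
    simp only [Finset.mem_inter, mem_neighborFinset] at hz
    rcases hE.closed x hx z hz.2 with hzR | hzS
    · exact hE.not_adj_component hu hp huq hzR (le_oGraph hz.1)
    · exact hE.not_adj_isAttachment hO hu hp hup huq
        ⟨hzS, x, hx, hz.2.symm⟩ hzu (le_oGraph hz.1)

end IsExtremal

lemma FanOrShi.symm (h : FanOrShi G u v) : FanOrShi G v u := by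
  unfold FanOrShi at *
  rw [Finset.inter_comm]
  tauto

/-- The condition on induced copies of `Z₂`. -/
def Z2Condition (G : SimpleGraph V) [DecidableRel G.Adj] : Prop :=
  ∀ a1 a2 a3 b1 c1 : V, IsInducedZ2 G a1 a2 a3 b1 c1 → FanOrShi G a2 b1 ∧ FanOrShi G a3 b1

namespace IsExtremal

/-- If `u`, `v` and `x` form a triangle and the neighbours of `u` on the cycle are adjacent, then
`u` can be moved along the cycle towards `v` until it is followed by a heavy vertex. -/
lemma exists_heavy (hE : IsExtremal G S R) (hO : OHeavy G) (hZ : Z2Condition G)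
    (hx : x ∈ R) (hux : G.Adj u x) (hvx : G.Adj v x) (huv : G.Adj u v)
    (h : IsSplitCycle G S u v p a b q s₁ s₂) (hpq : G.Adj p q) :
    ∃ p' q' s₁' s₂', IsSplitCycle G S u v p' a b q' s₁' s₂' ∧ Heavy G p' := by
  induction hn : s₁.card generalizing p q s₁ s₂ with
  | zero =>
    rw [Finset.card_eq_zero] at hn
    exact absurd h.path₁.left_mem (by simp [hn])
  | succ n ih =>
    by_cases hp : Heavy G p
    · exact ⟨p, q, s₁, s₂, h, hp⟩
    have huS : u ∈ S := by simp [h.eq]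
    have hvS : v ∈ S := by simp [h.eq]
    have hu : IsAttachment G S R u := ⟨huS, x, hx, hux⟩
    have hv : IsAttachment G S R v := ⟨hvS, x, hx, hvx⟩
    have hpv : ¬G.Adj p v := fun e => hE.not_adj_pv hO hu hv h (le_oGraph e)
    have hpx : ¬G.Adj p x := fun e =>
      hE.not_adj_component hu h.pathOn_erase h.adj_uq hx (le_oGraph e)
    obtain ⟨rfl, -⟩ | ⟨w, s, hpw, hw, hps, rfl⟩ := h.path₁.eq_single_or_exists_cons
    · exact absurd h.adj_va.symm hpv
    have hu₁ := h.notMem_u₁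
    have hv₁ := h.notMem_v₁
    have hd := h.disjoint
    simp only [Finset.mem_insert, not_or, Finset.disjoint_insert_left] at hu₁ hv₁ hd
    have hwS : w ∈ S := by simp [h.eq, hw.left_mem]
    have hwu : w ≠ u := fun e => hu₁.2 (e ▸ hw.left_mem)
    have huw : G.Adj u w := by
      by_contra huw
      have hxw : ¬G.Adj w x := fun e =>
        hE.not_adj_isAttachment hO hu h.pathOn_erase h.adj_up h.adj_uq
          ⟨hwS, x, hx, e⟩ hwu (le_oGraph hpw)
      have hZ2 : IsInducedZ2 G u x v p w :=
        ⟨hux, huv, hvx.symm, h.adj_up, hpw, fun e => hE.notMem x hx (e ▸ h.p_mem), h.p_ne_v,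
          hwu, fun e => hE.notMem x hx (e ▸ hwS), fun e => hv₁.2 (e ▸ hw.left_mem), hpx, hpv,
          fun e => huw e.symm, hxw, hE.not_adj_succ hO hu hv h hw hps rfl⟩
      exact hp (hE.heavy_of_fanOrShi hO hu h.pathOn_erase h.adj_up h.adj_uq hx
        (hZ _ _ _ _ _ hZ2).1.symm)
    have h' : IsSplitCycle G S u v w a b p s (s₂ ∪ {p}) :=
      { adj_up := huw
        adj_uq := h.adj_up
        adj_va := h.adj_va
        adj_vb := h.adj_vb
        path₁ := hw
        path₂ := h.path₂.append (.single p) hpq.symm (by simpa using hd.1)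
        ne := h.ne
        notMem_u₁ := hu₁.2
        notMem_u₂ := by simp [hu₁.1, h.notMem_u₂]
        notMem_v₁ := hv₁.2
        notMem_v₂ := by simp [hv₁.1, h.notMem_v₂]
        disjoint := by simp [hd.2, hps]
        eq := by rw [h.eq]; ext; simp }
    rw [Finset.card_insert_of_notMem hps] at hn
    exact ih h' hpw.symm (by omega)

lemma not_adj_of_triangle (hE : IsExtremal G S R) (hO : OHeavy G) (hZ : Z2Condition G)
    (hx : x ∈ R) (hux : G.Adj u x) (hvx : G.Adj v x) (huv : G.Adj u v)
    (h : IsSplitCycle G S u v p a b q s₁ s₂) : ¬G.Adj p q := by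
  intro hpq
  have hu : IsAttachment G S R u := ⟨by simp [h.eq], x, hx, hux⟩
  have hv : IsAttachment G S R v := ⟨by simp [h.eq], x, hx, hvx⟩
  obtain ⟨p', q', t₁, t₂, h', hp'⟩ := hE.exists_heavy hO hZ hx hux hvx huv h hpq
  have hb : ¬Heavy G b := fun hb =>
    hE.not_adj_pb hu hv h' (oGraph_adj_of_heavy h'.p_ne_b hp' hb)
  obtain ⟨q'', p'', r₁, r₂, h'', hq''⟩ :=
    hE.exists_heavy hO hZ hx hux hvx huv h.reverse hpq.symm
  have ha : ¬Heavy G a := fun ha =>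
    hE.not_adj_pb hu hv h'' (oGraph_adj_of_heavy h''.p_ne_b hq'' ha)
  have hba : G.Adj b a := by
    refine (hE.adj_pq hO hv h.rotate).2.resolve_right fun hd => ?_
    unfold Heavy at ha hb
    omega
  obtain ⟨b', a', r₁, r₂, h''', hb'⟩ :=
    hE.exists_heavy hO hZ hx hvx hux huv.symm h'.rotate hba
  exact hE.not_adj_pb hv hu h''' (oGraph_adj_of_heavy h'''.p_ne_b hb' hp')

lemma card_le_degree_add_degree (hE : IsExtremal G S R) (hO : OHeavy G) (hZ : Z2Condition G)
    (hu : IsAttachment G S R u) (hv : IsAttachment G S R v)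
    (h : IsSplitCycle G S u v p a b q s₁ s₂) :
    Fintype.card V ≤ G.degree p + G.degree q := by
  by_cases hpq : G.Adj p q
  swap
  · exact (hE.adj_pq hO hu h).2.resolve_left hpq
  by_cases hy : ∃ x ∈ R, G.Adj u x ∧ ∃ y, G.Adj x y ∧ y ≠ u ∧ ¬G.Adj y u
  · obtain ⟨x, hx, hux, y, hxy, hyu, hnyu⟩ := hy
    have key : ∀ {p q}, PathOn G p q (S.erase u) → G.Adj u p → G.Adj u q →
        x ≠ p ∧ ¬G.Adj x p ∧ y ≠ p ∧ ¬G.Adj y p := by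
      intro p q hp hup huq
      have hpS : p ∈ S := Finset.mem_of_mem_erase hp.left_mem
      have hxp : ¬G.Adj x p := fun e =>
        hE.not_adj_component hu hp huq hx (le_oGraph e.symm)
      refine ⟨fun e => hE.notMem x hx (e ▸ hpS), hxp, fun e => hxp (e ▸ hxy), fun e => ?_⟩
      rcases hE.closed x hx y hxy with hyR | hyS
      · exact hE.not_adj_component hu hp huq hyR (le_oGraph e.symm)
      · exact hE.not_adj_isAttachment hO hu hp hup huq
          ⟨hyS, x, hx, hxy.symm⟩ hyu (le_oGraph e.symm)
    obtain ⟨k₁, k₂, k₃, k₄⟩ := key h.pathOn_erase h.adj_up h.adj_uq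
    obtain ⟨l₁, l₂, l₃, l₄⟩ := key h.reverse.pathOn_erase h.adj_uq h.adj_up
    obtain ⟨f₁, f₂⟩ := hZ u p q x y ⟨h.adj_up, h.adj_uq, hpq, hux, hxy, k₁, l₁, hyu, k₃, l₃,
      k₂, l₂, hnyu, k₄, l₄⟩
    have hp := hE.heavy_of_fanOrShi hO hu h.pathOn_erase h.adj_up h.adj_uq hx f₁
    have hq := hE.heavy_of_fanOrShi hO hu h.reverse.pathOn_erase h.adj_uq h.adj_up hx f₂
    unfold Heavy at hp hq
    omega
  · exfalso
    push Not at hy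
    obtain ⟨-, y, hyR, hvy⟩ := id hv
    obtain ⟨huS, x, hx, hux⟩ := id hu
    obtain ⟨t, ht, htS⟩ := hE.connected x hx y hyR
    have key : ∀ {i j t}, PathOn G i j t → Disjoint t S → i ∈ R → G.Adj u i → G.Adj u j := by
      intro i j t hp
      induction hp with
      | single => exact fun _ _ h => h
      | @cons i k j t hik hi hp ih =>
        intro ht hiR hui
        rw [Finset.disjoint_insert_left] at ht
        have hkS : k ∉ S := Finset.disjoint_left.1 ht.2 hp.left_mem
        exact ih ht.2 ((hE.closed i hiR k hik).resolve_right hkS)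
          (hy i hiR hui k hik (fun e => hkS (e ▸ huS))).symm
    have huy := key ht htS hx hux
    exact hE.not_adj_of_triangle hO hZ hyR huy hvy
      (hy y hyR huy v hvy.symm h.ne.symm).symm h hpq

lemma false_of_isAttachment (hE : IsExtremal G S R) (hO : OHeavy G) (hZ : Z2Condition G)
    (hu : IsAttachment G S R u) (hv : IsAttachment G S R v) (hvu : v ≠ u) : False := by
  obtain ⟨p, q, hp, hup, huq⟩ := (hE.cycleOn.of_oGraph hE.maximal).exists_pathOn_erase hu.1
  have hvp : v ≠ p := fun e => hE.not_isAttachment hu hp huq (e ▸ hv)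
  have hvq : v ≠ q := fun e => hE.not_isAttachment hu hp.reverse hup (e ▸ hv)
  obtain ⟨a, b, s₁, s₂, h⟩ := hp.exists_isSplitCycle hu.1 hup huq hv.1 hvu hvp hvq
  have h₁ := hE.card_le_degree_add_degree hO hZ hu hv h
  have h₂ := hE.card_le_degree_add_degree hO hZ hv hu h.rotate
  have h₃ : ¬Fintype.card V ≤ G.degree p + G.degree b := fun hd =>
    hE.not_adj_pb hu hv h ⟨h.p_ne_b, .inr hd⟩
  have h₄ : ¬Fintype.card V ≤ G.degree q + G.degree a := fun hd =>
    hE.not_adj_pb hu hv h.reverse ⟨h.reverse.p_ne_b, .inr hd⟩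
  omega

end IsExtremal

end Extremal

section Existence

variable {V : Type*}

/-- The graph `G` with all edges meeting `S` removed. -/
def avoiding (G : SimpleGraph V) (S : Set V) : SimpleGraph V where
  Adj a b := G.Adj a b ∧ a ∉ S ∧ b ∉ S
  symm := ⟨fun _ _ h => ⟨h.1.symm, h.2.2, h.2.1⟩⟩
  loopless := ⟨fun _ h => G.loopless.irrefl _ h.1⟩

lemma avoiding_le (G : SimpleGraph V) (S : Set V) : avoiding G S ≤ G := fun _ _ h => h.1

lemma PathOn.notMem_of_avoiding [DecidableEq V] {G : SimpleGraph V} {S : Set V} {a b : V}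
    {s : Finset V} (h : PathOn (avoiding G S) a b s) (ha : a ∉ S) : ∀ y ∈ s, y ∉ S := by
  induction h with
  | single => simpa using ha
  | cons hab _ _ ih =>
    intro y hy
    rcases Finset.mem_insert.1 hy with rfl | hy
    exacts [ha, ih hab.2.2 y hy]

lemma exists_pathOn_of_isClique [DecidableEq V] {G : SimpleGraph V} {s : Finset V}
    (hs : s.Nonempty) (hc : G.IsClique (s : Set V)) :
    ∃ a b, PathOn G a b s := by
  induction hs using Finset.Nonempty.cons_induction with
  | singleton a => exact ⟨a, a, .single a⟩
  | cons a s ha hs ih =>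
    obtain ⟨b, c, hp⟩ := ih (hc.subset (by simp))
    refine ⟨a, c, ?_⟩
    rw [Finset.cons_eq_insert]
    exact .cons (hc (by simp) (by simp [hp.left_mem]) fun e => ha (e ▸ hp.left_mem)) ha hp

variable [Fintype V] {G : SimpleGraph V}

lemma TwoConnected.mem_of_closed (h2 : TwoConnected G) {v x y : V} {T : Set V}
    (hT : ∀ i ∈ T, ∀ j, G.Adj i j → j ≠ v → j ∈ T) (hx : x ∈ T) (hxv : x ≠ v) (hyv : y ≠ v) :
    y ∈ T := by
  obtain ⟨p⟩ := (h2.2 v).preconnected ⟨x, hxv⟩ ⟨y, hyv⟩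
  have key : ∀ {i j : {w | w ≠ v}}, (G.induce {w | w ≠ v}).Walk i j → (i : V) ∈ T →
      (j : V) ∈ T := by
    intro i j p
    induction p with
    | nil => exact id
    | @cons i k j h p ih => exact fun hi => ih (hT _ hi _ h k.2)
  exact key p hx

lemma TwoConnected.exists_ne_ne (h2 : TwoConnected G) (a b : V) : ∃ c, c ≠ a ∧ c ≠ b := by
  classical
  by_contra! h
  have h₁ : (Finset.univ : Finset V) ⊆ {a, b} := fun c _ => by
    by_cases hc : c = a
    · simp [hc]
    · simp [h c hc]
  have := Finset.card_le_card h₁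
  have := Finset.card_le_two (a := a) (b := b)
  have := h2.1
  rw [Finset.card_univ] at *
  omega

lemma TwoConnected.exists_adj_ne (h2 : TwoConnected G) {a b : V} (hab : a ≠ b) :
    ∃ c, G.Adj a c ∧ c ≠ b := by
  obtain ⟨d, hda, hdb⟩ := h2.exists_ne_ne a b
  by_contra! h
  exact hda (h2.mem_of_closed (T := {a})
    (fun i hi j hij hj => absurd (h j (Set.mem_singleton_iff.1 hi ▸ hij)) hj) rfl hab hdb)

lemma TwoConnected.exists_isAttachment_ne (h2 : TwoConnected G) {S : Finset V} {R : Set V}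
    (hS : 3 ≤ S.card) (hRS : ∀ x ∈ R, x ∉ S) (hR : ∀ x ∈ R, ∀ y, G.Adj x y → y ∈ R ∨ y ∈ S)
    {x v : V} (hx : x ∈ R) (hv : v ∈ S) : ∃ u, IsAttachment G S R u ∧ u ≠ v := by
  by_contra! h
  obtain ⟨y, hyS, hyv⟩ := Finset.exists_mem_ne (show 1 < S.card by omega) v
  refine hRS y (h2.mem_of_closed (T := R) (fun i hi j hij hj => ?_) hx
    (fun e => hRS x hx (e ▸ hv)) hyv) hyS
  exact (hR i hi j hij).resolve_right fun hjS => hj (h j ⟨hjS, i, hi, hij.symm⟩)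

variable [DecidableEq V]

lemma TwoConnected.exists_cycleOn (h2 : TwoConnected G) {K : SimpleGraph V} (hGK : G ≤ K)
    {a b : V} (hab : K.Adj a b) : ∃ s, CycleOn K s ∧ a ∈ s ∧ b ∈ s := by
  obtain ⟨c, hac, hcb⟩ := h2.exists_adj_ne hab.ne
  have hb : (avoiding G {a}).Reachable c b :=
    h2.mem_of_closed (v := a) (T := {y | (avoiding G {a}).Reachable c y ∧ y ≠ a})
      (fun i hi j hij hj => ⟨hi.1.trans (Adj.reachable ⟨hij, hi.2, hj⟩), hj⟩)
      ⟨.rfl, hac.ne'⟩ hac.ne' hab.ne' |>.1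
  obtain ⟨t, ht⟩ := PathOn.exists_of_reachable hb
  have hat : a ∉ t := fun h => ht.notMem_of_avoiding hac.ne' a h rfl
  refine ⟨insert a t, ⟨?_, a, b, .cons (hGK hac) hat (ht.mono ((avoiding_le _ _).trans hGK)),
    hab.symm⟩, by simp, by simp [ht.right_mem]⟩
  have hsub : ({c, b} : Finset V) ⊆ t := by
    simp [Finset.insert_subset_iff, ht.left_mem, ht.right_mem]
  have := Finset.card_le_card hsub
  rw [Finset.card_pair hcb] at this
  rw [Finset.card_insert_of_notMem hat]
  omega

lemma TwoConnected.exists_cycleOn_heavy [DecidableRel G.Adj] (h2 : TwoConnected G) :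
    ∃ s, CycleOn (oGraph G) s ∧ ∀ v, Heavy G v → v ∈ s := by
  classical
  set H := Finset.univ.filter (Heavy G) with hH
  have hmem : ∀ v, Heavy G v ↔ v ∈ H := by simp [hH]
  simp only [hmem]
  rcases le_or_gt 3 H.card with h3 | h3
  · have hcl : (oGraph G).IsClique (H : Set V) := fun a ha b hb hab =>
      oGraph_adj_of_heavy hab ((hmem a).2 ha) ((hmem b).2 hb)
    obtain ⟨a, b, hp⟩ :=
      exists_pathOn_of_isClique (Finset.card_pos.1 (by omega)) hcl
    refine ⟨H, ⟨h3, a, b, hp, hcl hp.right_mem hp.left_mem ?_⟩, fun _ => id⟩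
    rintro rfl
    rw [hp.eq_singleton] at h3
    simp at h3
  · suffices h : ∃ a b, (oGraph G).Adj a b ∧ H ⊆ {a, b} by
      obtain ⟨a, b, hab, hsub⟩ := h
      obtain ⟨s, hs, ha, hb⟩ := h2.exists_cycleOn le_oGraph hab
      refine ⟨s, hs, fun v hv => ?_⟩
      have := hsub hv
      simp only [Finset.mem_insert, Finset.mem_singleton] at this
      rcases this with rfl | rfl <;> assumption
    rcases eq_or_ne H.card 2 with hc | hc
    · obtain ⟨a, b, hab, he⟩ := Finset.card_eq_two.1 hc
      refine ⟨a, b, oGraph_adj_of_heavy hab ?_ ?_, he.le⟩ <;> simp [hmem, he]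
    · have : Nonempty V := Fintype.card_pos_iff.1 (by have := h2.1; omega)
      obtain ⟨a, ha⟩ := Finset.card_le_one_iff_subset_singleton.1 (show H.card ≤ 1 by omega)
      obtain ⟨d, hd, -⟩ := h2.exists_ne_ne a a
      obtain ⟨b, hab, -⟩ := h2.exists_adj_ne hd.symm
      exact ⟨a, b, le_oGraph hab, ha.trans (by simp)⟩

end Existence

/-- **Theorem 10 of the paper.** Let `G` be a 2-connected o-heavy graph. If for
every induced copy of `Z₂` (triangle `a₁a₂a₃` with attached path `a₁b₁c₁`) each
of the pairs `{a₂,b₁}` and `{a₃,b₁}` satisfies Fan's or Shi's condition, then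
`G` is Hamiltonian. -/
theorem ning_zhang_chen_th10 {V : Type*} [Fintype V] [DecidableEq V]
    (G : SimpleGraph V) [DecidableRel G.Adj]
    (h2 : TwoConnected G)
    (hheavy : OHeavy G)
    (h : ∀ a1 a2 a3 b1 c1 : V, IsInducedZ2 G a1 a2 a3 b1 c1 →
      FanOrShi G a2 b1 ∧ FanOrShi G a3 b1) :
    G.IsHamiltonian := by
  obtain ⟨s, hs, hsH⟩ := h2.exists_cycleOn_heavy
  obtain ⟨S, hsS, hS, hmax⟩ := Finite.exists_le_maximal
    (p := fun s => CycleOn (oGraph G) s) hs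
  have hmax' : ∀ t, CycleOn (oGraph G) t → S ⊆ t → t = S := fun t ht hSt =>
    (hmax ht hSt).antisymm hSt
  rcases eq_or_ne S Finset.univ with rfl | hne
  · exact (hS.of_oGraph hmax').isHamiltonian
  exfalso
  obtain ⟨x, hx⟩ : ∃ x, x ∉ S := by
    by_contra! h
    exact hne (Finset.eq_univ_iff_forall.2 h)
  let K := avoiding G (S : Set V)
  have hE : IsExtremal G S {y | K.Reachable x y ∧ y ∉ S} :=
    { cycleOn := hS
      maximal := hmax'
      heavy_mem := fun v hv => hsS (hsH v hv)
      notMem := fun y hy => hy.2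
      connected := fun y hy z hz => by
        obtain ⟨t, ht⟩ := PathOn.exists_of_reachable (hy.1.symm.trans hz.1)
        exact ⟨t, ht.mono (avoiding_le _ _),
          Finset.disjoint_left.2 (ht.notMem_of_avoiding hy.2)⟩
      closed := fun y hy z hyz => by
        by_cases hz : z ∈ S
        · exact .inr hz
        · exact .inl ⟨hy.1.trans (Adj.reachable ⟨hyz, hy.2, hz⟩), hz⟩ }
  obtain ⟨w, hw⟩ := Finset.card_pos.1 (show 0 < S.card by have := hS.1; omega)
  have hxR : x ∈ {y | K.Reachable x y ∧ y ∉ S} := ⟨.rfl, hx⟩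
  obtain ⟨u, hu, -⟩ := h2.exists_isAttachment_ne hS.1 hE.notMem hE.closed hxR hw
  obtain ⟨v, hv, hvu⟩ := h2.exists_isAttachment_ne hS.1 hE.notMem hE.closed hxR hu.1
  exact hE.false_of_isAttachment hheavy h hu hv hvu
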